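/- The numerical semigroup ⟨101, 102, 110, 111⟩ is not a 3-quotient: there do not exist positive integers d, a₁, a₂, a₃ such that ⟨101, 102, 110, 111⟩ = ⟨a₁, a₂, a₃⟩/d. -/

import Mathlib

open scoped BigOperators

/-- The cone generated by the vectors `v i` in `ℝ^m`: all nonnegative real combinations. -/
def coneGen {m l : ℕ} (v : Fin l → (Fin m → ℝ)) : Set (Fin m → ℝ) :=
  {x | ∃ c : Fin l → ℝ, (∀ i, 0 ≤ c i) ∧ x = ∑ i, c i • v i}

/-- Coercion of an integer vector to a real vector. -/
def toReal {m : ℕ} (z : Fin m → ℤ) : Fin m → ℝ := fun i => (z i : ℝ)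

/-- A numerical semigroup: contains 0 and is closed under addition. -/
def IsNumericalSemigroup (S : Set ℕ) : Prop :=
  0 ∈ S ∧ ∀ a ∈ S, ∀ b ∈ S, a + b ∈ S

/-- The numerical semigroup `⟨a 1, …, a n⟩` generated by the `a i`. -/
def numGen {n : ℕ} (a : Fin n → ℕ) : Set ℕ :=
  {t | ∃ x : Fin n → ℕ, t = ∑ i, a i * x i}

/-- The quotient `T/d = {t ∈ ℕ : d t ∈ T}`. -/
def numQuot (T : Set ℕ) (d : ℕ) : Set ℕ := {t | d * t ∈ T}

/-- `S` is a `k`-quotient: `S = ⟨a 1, …, a k⟩ / d` for positive integers `d, a i`. -/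
def IsKQuotient (k : ℕ) (S : Set ℕ) : Prop :=
  ∃ (d : ℕ) (a : Fin k → ℕ), 0 < d ∧ (∀ i, 0 < a i) ∧ S = numQuot (numGen a) d

/-- `S` is `k`-ray-normalescent: `S = π(C ∩ ℤ^m)` where `C ⊆ ℝ^m` is a rational polyhedral
cone generated by `k` integer vectors (so with at most `k` extreme rays) and `π` is a linear
functional with integer coefficients `p` satisfying `π(C) ⊆ ℝ≥0`. -/
def IsKRayNormalescent (k : ℕ) (S : Set ℕ) : Prop :=
  ∃ (m : ℕ) (v : Fin k → (Fin m → ℤ)) (p : Fin m → ℤ),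
    (∀ x ∈ coneGen (fun i => toReal (v i)), 0 ≤ ∑ j, (p j : ℝ) * x j) ∧
    {t : ℤ | ∃ z : Fin m → ℤ, toReal z ∈ coneGen (fun i => toReal (v i)) ∧
        t = ∑ j, p j * z j} = (fun n : ℕ => (n : ℤ)) '' S

/-- `S` is `k`-normalescent: `S = π(C ∩ ℤ^m)` where `C ⊆ ℝ^m` is a `k`-dimensional rational
polyhedral cone and `π` is a linear functional with integer coefficients `p` with
`π(C) ⊆ ℝ≥0`. -/
def IsKNormalescent (k : ℕ) (S : Set ℕ) : Prop :=
  ∃ (m l : ℕ) (v : Fin l → (Fin m → ℤ)) (p : Fin m → ℤ),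
    Module.finrank ℝ (Submodule.span ℝ (Set.range (fun i => toReal (v i)))) = k ∧
    (∀ x ∈ coneGen (fun i => toReal (v i)), 0 ≤ ∑ j, (p j : ℝ) * x j) ∧
    {t : ℤ | ∃ z : Fin m → ℤ, toReal z ∈ coneGen (fun i => toReal (v i)) ∧
        t = ∑ j, p j * z j} = (fun n : ℕ => (n : ℤ)) '' S

/-- If `d * m` is an integer combination of the `a i` with nonnegative coefficients, then `m` lies
in the quotient `⟨a 1, a 2, a 3⟩ / d`. -/
theorem mem_numQuot_of_nonneg {d m : ℕ} {a : Fin 3 → ℕ} {z : Fin 3 → ℤ} (hz : ∀ i, 0 ≤ z i)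
    (h : (d : ℤ) * m = a 0 * z 0 + a 1 * z 1 + a 2 * z 2) : m ∈ numQuot (numGen a) d := by
  refine ⟨fun i => (z i).toNat, ?_⟩
  zify
  simp only [Fin.sum_univ_three, Int.toNat_of_nonneg (hz _), h]

theorem mem_numGen_iff {t : ℕ} : t ∈ numGen ![101, 102, 110, 111] ↔
    ∃ x y z w : ℕ, t = 101 * x + 102 * y + 110 * z + 111 * w := by
  constructor
  · rintro ⟨x, hx⟩
    exact ⟨x 0, x 1, x 2, x 3, by simpa [Fin.sum_univ_four] using hx⟩
  · rintro ⟨x, y, z, w, h⟩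
    exact ⟨![x, y, z, w], by simpa [Fin.sum_univ_four] using h⟩

/-- Four linear forms of which at most one can be negative at a given nonnegative vector: at three
nonnegative vectors, one of the forms is nonnegative throughout. -/
theorem exists_form_nonneg (p q r s : Fin 3 → ℕ) :
    (∀ i, (0 : ℤ) ≤ -2 * p i + q i + 4 * r i + 2 * s i) ∨
    (∀ i, (0 : ℤ) ≤ 4 * p i - 2 * q i + 2 * r i + s i) ∨
    (∀ i, (0 : ℤ) ≤ p i + 2 * q i - 2 * r i + 4 * s i) ∨
    (∀ i, (0 : ℤ) ≤ 2 * p i + 4 * q i + r i - 2 * s i) := by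
  by_contra! ⟨⟨i, hi⟩, ⟨j, hj⟩, ⟨k, hk⟩, ⟨l, hl⟩⟩
  have hij : i ≠ j := by rintro rfl; omega
  have hik : i ≠ k := by rintro rfl; omega
  have hil : i ≠ l := by rintro rfl; omega
  have hjk : j ≠ k := by rintro rfl; omega
  have hjl : j ≠ l := by rintro rfl; omega
  have hkl : k ≠ l := by rintro rfl; omega
  omega

/-- `⟨101, 102, 110, 111⟩` is not a 3-quotient. -/
theorem example_not_3quotient :
    ¬ IsKQuotient 3 (numGen ![101, 102, 110, 111]) := by
  rintro ⟨d, a, -, -, hS⟩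
  have key (x y z w : ℕ) :
      101 * x + 102 * y + 110 * z + 111 * w ∈ numQuot (numGen a) d :=
    hS ▸ mem_numGen_iff.2 ⟨x, y, z, w, rfl⟩
  obtain ⟨p, hp⟩ := key 1 0 0 0
  obtain ⟨q, hq⟩ := key 0 1 0 0
  obtain ⟨r, hr⟩ := key 0 0 1 0
  obtain ⟨s, hs⟩ := key 0 0 0 1
  simp only [Fin.sum_univ_three] at hp hq hr hs
  zify at hp hq hr hs
  have gap {m : ℕ} (hm : m ∈ numQuot (numGen a) d) :
      ∃ x y z w : ℕ, m = 101 * x + 102 * y + 110 * z + 111 * w :=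
    mem_numGen_iff.1 (hS ▸ hm)
  rcases exists_form_nonneg p q r s with h | h | h | h
  · obtain ⟨x, y, z, w, e⟩ := gap (m := 562) (mem_numQuot_of_nonneg h (by
      push_cast; linear_combination -2 * hp + hq + 4 * hr + 2 * hs))
    have : z ≤ 5 := by omega
    have : w ≤ 5 := by omega
    interval_cases z <;> interval_cases w <;> omega
  · obtain ⟨x, y, z, w, e⟩ := gap (m := 531) (mem_numQuot_of_nonneg h (by
      push_cast; linear_combination 4 * hp - 2 * hq + 2 * hr + hs))
    have : z ≤ 5 := by omega
    have : w ≤ 5 := by omega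
    interval_cases z <;> interval_cases w <;> omega
  · obtain ⟨x, y, z, w, e⟩ := gap (m := 529) (mem_numQuot_of_nonneg h (by
      push_cast; linear_combination hp + 2 * hq - 2 * hr + 4 * hs))
    have : z ≤ 5 := by omega
    have : w ≤ 5 := by omega
    interval_cases z <;> interval_cases w <;> omega
  · obtain ⟨x, y, z, w, e⟩ := gap (m := 498) (mem_numQuot_of_nonneg h (by
      push_cast; linear_combination 2 * hp + 4 * hq + hr - 2 * hs))
    have : z ≤ 5 := by omega
    have : w ≤ 5 := by omega
    interval_cases z <;> interval_cases w <;> omega
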